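/- Let f : [0, τ] → ℝ be continuously differentiable with |f'(s)| ≤ K_1 for all s ∈ [0, τ], and suppose additionally that ψ is even. Define a_n(t) := n^{1/3} ∫_0^τ (s − t) ψ(n^{1/3}(s − t)) f(s) ds. Then for every n with 2 n^{−1/3} ≤ τ and every t ∈ [n^{−1/3}, τ − n^{−1/3}]: |a_n(t)| ≤ K_1 n^{−2/3} ∫_{−1}^{1} u² ψ(u) du. -/

import Mathlib

open MeasureTheory intervalIntegral

noncomputable section

/-- The first moment of an even function over `[-1, 1]` vanishes. -/
lemma integral_id_mul_even_eq_zero {ψ : ℝ → ℝ} (hψeven : ∀ x, ψ (-x) = ψ x) :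
    ∫ u in (-1 : ℝ)..1, u * ψ u = 0 := by
  have h := intervalIntegral.integral_comp_neg (a := -1) (b := 1) (fun u : ℝ => u * ψ u)
  simp only [hψeven, neg_mul, intervalIntegral.integral_neg, neg_neg] at h
  linarith

/-- Rescaling by `m` and localising to the support `(-1, 1)` of the kernel. -/
lemma integral_kernel_rescale {τ m t : ℝ} {ψ f : ℝ → ℝ} (hm : 0 < m)
    (hψsupp : Function.support ψ ⊆ Set.Ioo (-1) 1)
    (ht0 : m⁻¹ ≤ t) (htτ : t ≤ τ - m⁻¹) :
    m * ∫ s in (0 : ℝ)..τ, (s - t) * ψ (m * (s - t)) * f s =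
      m⁻¹ * ∫ u in (-1 : ℝ)..1, u * ψ u * f (t + u / m) := by
  set g : ℝ → ℝ := fun u => u * ψ u * f (t + u / m) with hg
  have hsupp : Function.support g ⊆ Set.Ioo (-1) 1 := fun u hu =>
    hψsupp fun h => hu (by simp [hg, h])
  have hsub : ∫ s in (0 : ℝ)..τ, (s - t) * ψ (m * (s - t)) * f s =
      m⁻¹ * ∫ s in (0 : ℝ)..τ, g (m * s - m * t) := by
    rw [← intervalIntegral.integral_const_mul]
    congr 1
    ext s
    have h1 : t + m * (s - t) / m = s := by rw [mul_div_cancel_left₀ _ hm.ne']; ring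
    simp only [hg, ← mul_sub, h1]
    field_simp
  have hlow : m * 0 - m * t ≤ -1 := by
    have := mul_le_mul_of_nonneg_left ht0 hm.le
    rw [mul_inv_cancel₀ hm.ne'] at this
    linarith
  have hupp : 1 ≤ m * τ - m * t := by
    have := mul_le_mul_of_nonneg_left htτ hm.le
    rw [mul_sub, mul_inv_cancel₀ hm.ne'] at this
    linarith
  rw [hsub, intervalIntegral.integral_comp_mul_sub _ hm.ne',
    intervalIntegral.integral_eq_integral_of_support_subset
      (hsupp.trans fun u hu => ⟨hlow.trans_lt hu.1, hu.2.le.trans hupp⟩),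
    intervalIntegral.integral_eq_integral_of_support_subset
      (hsupp.trans Set.Ioo_subset_Ioc_self), smul_eq_mul, mul_inv_cancel_left₀ hm.ne']

/-- second-order bound for
`a_n(t) = n^{1/3} ∫₀^τ (s − t) ψ(n^{1/3}(s − t)) f(s) ds` for a continuously
differentiable `f` with `|f'| ≤ K₁` on `[0, τ]` and an even kernel `ψ`:
for `n` with `2 n^{−1/3} ≤ τ` and `t ∈ [n^{−1/3}, τ − n^{−1/3}]`,
`|a_n(t)| ≤ K₁ n^{−2/3} ∫₋₁¹ u² ψ(u) du`. -/
theorem stmt19 (τ : ℝ) (hτ : 0 < τ)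
    (ψ : ℝ → ℝ) (hψ0 : ∀ x, 0 ≤ ψ x) (hψc : Continuous ψ)
    (hψsupp : Function.support ψ ⊆ Set.Ioo (-1) 1)
    (hψeven : ∀ x, ψ (-x) = ψ x)
    (K1 : ℝ) (f : ℝ → ℝ) (hf : ContDiff ℝ 1 f)
    (hK1 : ∀ s ∈ Set.Icc (0 : ℝ) τ, |deriv f s| ≤ K1)
    (n : ℕ) (hn : 1 ≤ n) (hnτ : 2 * (n : ℝ) ^ (-(1 : ℝ) / 3) ≤ τ)
    (t : ℝ) (ht : t ∈ Set.Icc ((n : ℝ) ^ (-(1 : ℝ) / 3)) (τ - (n : ℝ) ^ (-(1 : ℝ) / 3))) :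
    |(n : ℝ) ^ ((1 : ℝ) / 3) *
        ∫ s in (0 : ℝ)..τ, (s - t) * ψ ((n : ℝ) ^ ((1 : ℝ) / 3) * (s - t)) * f s| ≤
      K1 * (n : ℝ) ^ (-(2 : ℝ) / 3) * ∫ u in (-1 : ℝ)..1, u ^ 2 * ψ u := by
  set m : ℝ := (n : ℝ) ^ ((1 : ℝ) / 3) with hmdef
  have hn0 : (0 : ℝ) < n := by exact_mod_cast hn
  have hm : 0 < m := Real.rpow_pos_of_pos hn0 _
  have hinv : (n : ℝ) ^ (-(1 : ℝ) / 3) = m⁻¹ := by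
    rw [hmdef, ← Real.rpow_neg hn0.le, neg_div]
  have hinv2 : (n : ℝ) ^ (-(2 : ℝ) / 3) = m⁻¹ * m⁻¹ := by
    rw [← hinv, ← Real.rpow_add hn0]
    norm_num
  rw [hinv] at ht
  obtain ⟨ht0, htτ⟩ := ht
  have hmi : 0 < m⁻¹ := inv_pos.mpr hm
  have hfc : Continuous f := hf.continuous
  have hcentre : ∫ u in (-1 : ℝ)..1, u * ψ u * f (t + u / m) =
      ∫ u in (-1 : ℝ)..1, u * ψ u * (f (t + u / m) - f t) := by
    simp only [mul_sub]
    rw [intervalIntegral.integral_sub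
      (Continuous.intervalIntegrable (by fun_prop) _ _)
      (Continuous.intervalIntegrable (by fun_prop) _ _),
      intervalIntegral.integral_mul_const, integral_id_mul_even_eq_zero hψeven]
    ring
  have hbound : ∀ u ∈ Set.Ioc (-1 : ℝ) 1,
      ‖u * ψ u * (f (t + u / m) - f t)‖ ≤ K1 * m⁻¹ * (u ^ 2 * ψ u) := by
    intro u hu
    have hlo : -m⁻¹ ≤ u / m := by
      rw [div_eq_mul_inv]; nlinarith [hu.1]
    have hhi : u / m ≤ m⁻¹ := by
      rw [div_eq_mul_inv]; nlinarith [hu.2]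
    have hmvt := Convex.norm_image_sub_le_of_norm_deriv_le (𝕜 := ℝ) (f := f)
      (fun x _ => (hf.differentiable one_ne_zero) x) hK1 (convex_Icc 0 τ)
      (show t ∈ Set.Icc 0 τ from ⟨by linarith, by linarith⟩)
      (show t + u / m ∈ Set.Icc 0 τ from ⟨by linarith, by linarith⟩)
    rw [add_sub_cancel_left, Real.norm_eq_abs (u / m), abs_div, abs_of_pos hm] at hmvt
    rw [norm_mul, norm_mul, Real.norm_eq_abs u, Real.norm_of_nonneg (hψ0 u)]
    calc |u| * ψ u * ‖f (t + u / m) - f t‖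
        ≤ |u| * ψ u * (K1 * (|u| / m)) :=
          mul_le_mul_of_nonneg_left hmvt (mul_nonneg (abs_nonneg u) (hψ0 u))
      _ = K1 * m⁻¹ * (u ^ 2 * ψ u) := by rw [← sq_abs u]; ring
  have hint := intervalIntegral.norm_integral_le_of_norm_le (μ := volume)
    (by norm_num : (-1 : ℝ) ≤ 1) (Filter.Eventually.of_forall hbound)
    (Continuous.intervalIntegrable (by fun_prop) _ _)
  rw [intervalIntegral.integral_const_mul, Real.norm_eq_abs] at hint
  rw [integral_kernel_rescale hm hψsupp ht0 htτ, hcentre, abs_mul, abs_of_pos hmi, hinv2]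
  calc _ ≤ m⁻¹ * (K1 * m⁻¹ * ∫ u in (-1 : ℝ)..1, u ^ 2 * ψ u) :=
        mul_le_mul_of_nonneg_left hint hmi.le
    _ = _ := by ring
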